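/- For every j ≥ 1 and every 0 ≤ i ≤ T, almost surely Z_j(i) ≤ Z_1(i) + E[ Z_{j−1}(i+δ) | 𝓕_i ] (with the convention Z_{j−1}(m) = 0 for m > T): the marginal value of an extra exercise right is at most the single-stopping value plus the conditionally shifted (j−1)-right value. (Classical-expectation, discrete-time version of the inequality Y^{(i)}_t ≤ Y^{(1)}_t + 𝓔_t[Y^{(i−1)}_{t+δ}] in the paper's Proposition 4.2; the classical conditional expectation is sublinear.) -/

import Mathlib

open MeasureTheory Finset

/-- A measurable function dominated in square by an integrable
function is integrable on a finite measure space. -/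
lemma integrable_of_sq_le {Ω : Type*} {m0 : MeasurableSpace Ω} {μ : Measure Ω}
    [IsFiniteMeasure μ] {f g : Ω → ℝ} (hf : AEStronglyMeasurable f μ) (hg : Integrable g μ)
    (hfg : ∀ ω, f ω ^ 2 ≤ g ω) : Integrable f μ := by
  refine ((integrable_const (1 : ℝ)).add hg).mono' hf (ae_of_all _ fun ω => ?_)
  have h := hfg ω
  simp only [Pi.add_apply, Real.norm_eq_abs]
  nlinarith [sq_abs (f ω), sq_nonneg (|f ω| - 1), abs_nonneg (f ω)]

/-- Conditioning one step of a supermartingale-type inequality on an earlier sigma-algebra. -/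
lemma condExp_le_condExp_of_condExp_le {Ω : Type*} {m m' m0 : MeasurableSpace Ω} {μ : Measure Ω}
    [IsFiniteMeasure μ] (hmm' : m ≤ m') (hm' : m' ≤ m0) {f g : Ω → ℝ} (hg : Integrable g μ)
    (hfg : μ[f|m'] ≤ᵐ[μ] g) : μ[f|m] ≤ᵐ[μ] μ[g|m] :=
  (condExp_condExp_of_le hmm' hm').symm.le.trans (condExp_mono integrable_condExp hg hfg)

/-- Proposition 4.2, first inequality, discrete time, classical
expectation.  The marginal value of an extra exercise right is at most the
single-stopping value plus the conditionally shifted `(j-1)`-right value: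
`Z_j(i) ≤ Z_1(i) + E[Z_{j-1}(i+δ) | 𝓕_i]` a.s. -/
theorem value_subadditive_in_rights
    {Ω : Type*} {m0 : MeasurableSpace Ω}
    (μ : Measure Ω) [IsProbabilityMeasure μ]
    (ℱ : Filtration ℕ m0)
    (T δ : ℕ) (hδ : 1 ≤ δ)
    (X : ℕ → Ω → ℝ)
    (hXadp : Adapted ℱ X)
    (hXpos : ∀ n, 0 ≤ᵐ[μ] X n)
    (hXzero : ∀ n, T < n → X n = 0)
    (hXsq : Integrable (fun ω => ∑ n ∈ Finset.range (T + 1), (X n ω) ^ 2) μ)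
    (hFT : ∀ n, T ≤ n → ℱ n = ℱ T)
    (Z : ℕ → ℕ → Ω → ℝ)
    (hZzero : ∀ n, Z 0 n = 0)
    (hZT : ∀ j n, 1 ≤ j → T ≤ n → Z j n = X n)
    (hZrec : ∀ j n, 1 ≤ j → n < T →
      Z j n = fun ω =>
        max (X n ω + (μ[Z (j - 1) (n + δ)|ℱ n]) ω) ((μ[Z j (n + 1)|ℱ n]) ω))
    (j i : ℕ) (hj1 : 1 ≤ j) (hiT : i ≤ T) :
    ∀ᵐ ω ∂μ, Z j i ω ≤ Z 1 i ω + (μ[Z (j - 1) (i + δ)|ℱ i]) ω := by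
  have hXint : ∀ n, Integrable (X n) μ := by
    intro n
    rcases lt_or_ge T n with h | h
    · rw [hXzero n h]
      exact integrable_zero _ _ _
    · refine integrable_of_sq_le
        ((hXadp n).mono (ℱ.le n) le_rfl).aestronglyMeasurable hXsq fun ω => ?_
      exact Finset.single_le_sum (f := fun n => X n ω ^ 2) (fun _ _ => sq_nonneg _)
        (Finset.mem_range.2 (Nat.lt_succ_of_le h))
  have hZint : ∀ k n, Integrable (Z k n) μ := by
    intro k n
    rcases Nat.eq_zero_or_pos k with rfl | hk
    · rw [hZzero]
      exact integrable_zero _ _ _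
    rcases lt_or_ge n T with h | h
    · rw [hZrec k n hk h]
      exact ((hXint n).add integrable_condExp).sup integrable_condExp
    · rw [hZT k n hk h]
      exact hXint n
  have hZzero_of_lt : ∀ k n, T < n → Z k n = 0 := by
    intro k n h
    rcases Nat.eq_zero_or_pos k with rfl | hk
    · exact hZzero n
    · rw [hZT k n hk h.le, hXzero n h]
  have hZsuper : ∀ k n, μ[Z k (n + 1)|ℱ n] ≤ᵐ[μ] Z k n := by
    intro k n
    rcases Nat.eq_zero_or_pos k with rfl | hk
    · rw [hZzero, hZzero, condExp_zero]
    rcases lt_or_ge n T with h | h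
    · rw [hZrec k n hk h]
      exact ae_of_all _ fun ω => le_max_right _ _
    · rw [hZzero_of_lt k (n + 1) (by omega), condExp_zero, hZT k n hk h]
      exact hXpos n
  obtain ⟨d, hd⟩ := Nat.exists_eq_add_of_le hiT
  induction d generalizing i with
  | zero =>
    rw [hZzero_of_lt (j - 1) (i + δ) (by omega), condExp_zero, hZT j i hj1 (by omega),
      hZT 1 i le_rfl (by omega)]
    simp
  | succ d ih =>
    have hi : i < T := by omega
    have hstep : μ[Z j (i + 1)|ℱ i] ≤ᵐ[μ]
        μ[Z 1 (i + 1) + μ[Z (j - 1) (i + 1 + δ)|ℱ (i + 1)]|ℱ i] :=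
      condExp_mono (hZint _ _) ((hZint _ _).add integrable_condExp)
        (ih (i + 1) (by omega) (by omega))
    have hadd := condExp_add (m := ℱ i) (hZint 1 (i + 1))
      (integrable_condExp (μ := μ) (m := ℱ (i + 1)) (f := Z (j - 1) (i + 1 + δ)))
    have htower : μ[μ[Z (j - 1) (i + 1 + δ)|ℱ (i + 1)]|ℱ i]
        =ᵐ[μ] μ[Z (j - 1) (i + 1 + δ)|ℱ i] :=
      condExp_condExp_of_le (ℱ.mono (by omega)) (ℱ.le _)
    have hshift : μ[Z (j - 1) (i + 1 + δ)|ℱ i] ≤ᵐ[μ] μ[Z (j - 1) (i + δ)|ℱ i] := by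
      rw [Nat.add_right_comm i 1 δ]
      exact condExp_le_condExp_of_condExp_le (ℱ.mono (by omega)) (ℱ.le (i + δ)) (hZint _ _)
        (hZsuper _ _)
    filter_upwards [hstep, hadd, htower, hshift, hZsuper 1 i] with ω h1 h2 h3 h4 h5
    have hX : X i ω ≤ Z 1 i ω := by
      rw [hZrec 1 i le_rfl hi]
      simp [hZzero]
    rw [hZrec j i hj1 hi]
    simp only [Pi.add_apply] at h2
    refine max_le ?_ ?_ <;> linarith
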